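/- arXiv:math/0002197 — 2 statements merged into one kernel-verified Lean document; each statement's English description precedes it below -/
import Mathlib

section
/- A pair (θ, η) of holomorphic functions on a connected open set U ⊆ ℂ^n × ℂ^m is an infinitesimal symmetry of the trivial system (S_0): u^k_{x_i x_j} = 0 if and only if there exist a vector a ∈ ℂ^{n+m}, a complex linear map A : ℂ^{n+m} → ℂ^{n+m}, and a vector λ ∈ ℂ^{n+m} such that, writing Θ = (θ, η) : U → ℂ^{n+m} and w = (x, u) ∈ ℂ^{n+m}, one has Θ(w) = a + A(w) + (Σ_{s=1}^{n+m} λ_s w_s)·w for all w ∈ U. -/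
open scoped BigOperators

noncomputable section

/-- The space of independent and dependent variables `(x, u) ∈ ℂⁿ × ℂᵐ`. -/
abbrev Wsp (n m : ℕ) := (Fin n → ℂ) × (Fin m → ℂ)

/-- The space of first-order jet variables `q = (q_i^k)`, with `q k i` standing for
`∂u^k/∂x_i`. -/
abbrev Jsp (n m : ℕ) := Fin m → Fin n → ℂ

/-- The first-order jet space `ℂⁿ × ℂᵐ × ℂ^{mn}` with coordinates `(x, u, q)`. -/
abbrev Psp (n m : ℕ) := Wsp n m × Jsp n m

/-- Coordinate direction `∂/∂x_i` in the jet space. -/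
def dirx (n m : ℕ) (i : Fin n) : Psp n m := (((Pi.single i 1 : Fin n → ℂ), 0), 0)

/-- Coordinate direction `∂/∂u^k` in the jet space. -/
def diru (n m : ℕ) (k : Fin m) : Psp n m := ((0, (Pi.single k 1 : Fin m → ℂ)), 0)

/-- Coordinate direction `∂/∂q_j^k` in the jet space. -/
def dirq (n m : ℕ) (k : Fin m) (j : Fin n) : Psp n m :=
  ((0, 0), (Pi.single k (Pi.single j 1) : Fin m → Fin n → ℂ))

/-- The total derivative `D_i` applied to a function `ψ(x, u)` of the base
variables only: `D_i ψ = ∂ψ/∂x_i + Σ_k q_i^k ∂ψ/∂u^k`. -/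
def Dtot {n m : ℕ} (ψ : Wsp n m → ℂ) (i : Fin n) (p : Psp n m) : ℂ :=
  fderiv ℂ ψ p.1 ((Pi.single i 1 : Fin n → ℂ), 0)
    + ∑ k, p.2 k i * fderiv ℂ ψ p.1 (0, (Pi.single k 1 : Fin m → ℂ))

/-- The total derivative `D_i^F` of the system `(S_F)` applied to a function
`φ(x, u, q)`: `D_i^F φ = ∂φ/∂x_i + Σ_k q_i^k ∂φ/∂u^k + Σ_{k,j} F_{ij}^k ∂φ/∂q_j^k`. -/
def DtotF {n m : ℕ} (F : Fin n → Fin n → Fin m → Psp n m → ℂ)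
    (φ : Psp n m → ℂ) (i : Fin n) (p : Psp n m) : ℂ :=
  fderiv ℂ φ p (dirx n m i) + ∑ k, p.2 k i * fderiv ℂ φ p (diru n m k)
    + ∑ k, ∑ j, F i j k p * fderiv ℂ φ p (dirq n m k j)

/-- The first prolongation coefficient `η_i^μ = D_i η^μ − Σ_j (D_i θ_j) q_j^μ`. -/
def eta1 {n m : ℕ} (θ : Fin n → Wsp n m → ℂ) (η : Fin m → Wsp n m → ℂ)
    (μ : Fin m) (i : Fin n) (p : Psp n m) : ℂ :=
  Dtot (η μ) i p - ∑ j, Dtot (θ j) i p * p.2 μ j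

/-- The second prolongation coefficient `η_{ij}^μ = D_j^F η_i^μ − Σ_k (D_j θ_k) F_{ik}^μ`. -/
def eta2 {n m : ℕ} (F : Fin n → Fin n → Fin m → Psp n m → ℂ)
    (θ : Fin n → Wsp n m → ℂ) (η : Fin m → Wsp n m → ℂ)
    (μ : Fin m) (i j : Fin n) (p : Psp n m) : ℂ :=
  DtotF F (eta1 θ η μ i) j p - ∑ k, Dtot (θ k) j p * F i k μ p

/-- The pair `(θ, η)` is an infinitesimal symmetry of the system `(S_F)` on `U × Q`:
the determining identity
`η_{ij}^μ = Σ_s θ_s ∂F_{ij}^μ/∂x_s + Σ_k η^k ∂F_{ij}^μ/∂u^k + Σ_{k,l} η_l^k ∂F_{ij}^μ/∂q_l^k`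
holds identically on `U × Q` for all `i, j, μ`. -/
def IsSymmetry {n m : ℕ} (U : Set (Wsp n m)) (Q : Set (Jsp n m))
    (F : Fin n → Fin n → Fin m → Psp n m → ℂ)
    (θ : Fin n → Wsp n m → ℂ) (η : Fin m → Wsp n m → ℂ) : Prop :=
  ∀ p ∈ U ×ˢ Q, ∀ (i j : Fin n) (μ : Fin m),
    eta2 F θ η μ i j p =
      (∑ s, θ s p.1 * fderiv ℂ (F i j μ) p (dirx n m s))
      + (∑ k, η k p.1 * fderiv ℂ (F i j μ) p (diru n m k))
      + (∑ k, ∑ l, eta1 θ η k l p * fderiv ℂ (F i j μ) p (dirq n m k l))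

/-- The vector field `Z_i = ∂/∂x_i + Σ_k q_i^k ∂/∂u^k + Σ_{k,j} F_{ij}^k ∂/∂q_j^k`
on the jet space. -/
def Zfield {n m : ℕ} (F : Fin n → Fin n → Fin m → Psp n m → ℂ) (i : Fin n)
    (p : Psp n m) : Psp n m :=
  dirx n m i + (∑ k, p.2 k i • diru n m k) + ∑ k, ∑ j, F i j k p • dirq n m k j

/-- The system `(S_F)` is involutive: the fields `Z_i` pairwise commute on `U × Q`. -/
def IsInvolutive {n m : ℕ} (U : Set (Wsp n m)) (Q : Set (Jsp n m))
    (F : Fin n → Fin n → Fin m → Psp n m → ℂ) : Prop :=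
  ∀ p ∈ U ×ˢ Q, ∀ i j : Fin n,
    fderiv ℂ (Zfield F j) p (Zfield F i p) = fderiv ℂ (Zfield F i) p (Zfield F j p)


theorem hol_fderiv_bound {E F : Type*} [NormedAddCommGroup E] [NormedSpace ℂ E]
    [NormedAddCommGroup F] [NormedSpace ℂ F]
    {f : E → F} {w : E} {r C : ℝ} (hr : 0 < r) (hC : 0 ≤ C)
    (hd : DifferentiableOn ℂ f (Metric.ball w (2 * r)))
    (hb : ∀ z ∈ Metric.ball w (2 * r), ‖f z‖ ≤ C) : ‖fderiv ℂ f w‖ ≤ C / r := by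
  refine ContinuousLinearMap.opNorm_le_bound _ (by positivity) fun v => ?_
  rcases eq_or_ne v 0 with rfl | hv
  · simp
  have hv' : 0 < ‖v‖ := norm_pos_iff.2 hv
  have hmem : ∀ z ∈ Metric.closedBall (0 : ℂ) (r / ‖v‖), w + z • v ∈ Metric.ball w (2 * r) := by
    intro z hz
    rw [mem_closedBall_zero_iff, le_div_iff₀ hv'] at hz
    rw [mem_ball_iff_norm, add_sub_cancel_left, norm_smul]
    linarith
  have hD : ∀ z ∈ Metric.closedBall (0 : ℂ) (r / ‖v‖),
      HasDerivAt (fun z : ℂ => f (w + z • v)) (fderiv ℂ f (w + z • v) v) z := by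
    intro z hz
    have h1 := (hd.differentiableAt (Metric.isOpen_ball.mem_nhds (hmem z hz))).hasFDerivAt
    have h2 : HasDerivAt (fun z : ℂ => w + z • v) v z := by
      simpa using ((hasDerivAt_id z).smul_const v).const_add w
    exact h1.comp_hasDerivAt z h2
  have h0 := (hD 0 (by simp; positivity)).deriv
  have hdc : DiffContOnCl ℂ (fun z : ℂ => f (w + z • v)) (Metric.ball 0 (r / ‖v‖)) := by
    apply DifferentiableOn.diffContOnCl
    rw [closure_ball _ (by positivity)]
    exact fun z hz => (hD z hz).differentiableAt.differentiableWithinAt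
  have := Complex.norm_deriv_le_of_forall_mem_sphere_norm_le (by positivity) hdc
    (C := C) (fun z hz => hb _ (hmem z (Metric.sphere_subset_closedBall hz)))
  rw [h0, zero_smul, add_zero] at this
  calc _ ≤ _ := this
    _ = _ := by field_simp

theorem hol_fderiv_apply_diff {E F : Type*} [NormedAddCommGroup E] [NormedSpace ℂ E]
    [FiniteDimensional ℂ E]
    [NormedAddCommGroup F] [NormedSpace ℂ F] [FiniteDimensional ℂ F]
    {f : E → F} {U : Set E} (hU : IsOpen U) (hf : DifferentiableOn ℂ f U)
    {w₀ : E} (hw : w₀ ∈ U) (v : E) : DifferentiableAt ℂ (fun w => fderiv ℂ f w v) w₀ := by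
  have : CompleteSpace F := FiniteDimensional.complete ℂ F
  have : CompleteSpace E := FiniteDimensional.complete ℂ E
  have : ProperSpace E := FiniteDimensional.proper ℂ E
  have : ProperSpace (E →L[ℂ] F) := FiniteDimensional.proper ℂ _
  have hc : ContinuousAt f w₀ := (hf.differentiableAt (hU.mem_nhds hw)).continuousAt
  have hev : ∀ᶠ z in nhds w₀, z ∈ U ∧ ‖f z‖ ≤ ‖f w₀‖ + 1 :=
    (hU.eventually_mem hw).and
      ((hc.norm.eventually (gt_mem_nhds (lt_add_one ‖f w₀‖))).mono fun _ h => le_of_lt h)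
  obtain ⟨R, hR, hball⟩ := Metric.eventually_nhds_iff_ball.1 hev
  set C := ‖f w₀‖ + 1 with hCdef
  have hC : 0 ≤ C := by positivity
  obtain ⟨ρ, hρ, hρv⟩ : ∃ ρ : ℝ, 0 < ρ ∧ ρ * ‖v‖ < R / 4 := by
    refine ⟨R / 4 / (‖v‖ + 1), by positivity, ?_⟩
    rw [div_mul_eq_mul_div, div_lt_iff₀ (by positivity)]
    nlinarith [norm_nonneg v]
  have hmem : ∀ w ∈ Metric.ball w₀ (R / 4), ∀ z ∈ Metric.closedBall (0 : ℂ) ρ,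
      w + z • v ∈ Metric.ball w₀ (R / 2) := by
    intro w hw z hz
    rw [mem_closedBall_zero_iff] at hz
    rw [mem_ball_iff_norm] at hw ⊢
    have h1 : ‖w + z • v - w₀‖ ≤ ‖w - w₀‖ + ‖z • v‖ := by
      rw [add_sub_right_comm]; exact norm_add_le _ _
    rw [norm_smul] at h1
    nlinarith [norm_nonneg v]
  have hsub : Metric.ball w₀ (R / 2) ⊆ Metric.ball w₀ R := Metric.ball_subset_ball (by linarith)
  have hdf : ∀ z ∈ Metric.ball w₀ R, DifferentiableAt ℂ f z := fun z hz =>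
    hf.differentiableAt (hU.mem_nhds (hball z hz).1)
  have hbd : ∀ z ∈ Metric.ball w₀ (R / 2), ‖fderiv ℂ f z‖ ≤ C / (R / 4) := by
    intro z hz
    have hs : Metric.ball z (2 * (R / 4)) ⊆ Metric.ball w₀ R := by
      apply Metric.ball_subset_ball'
      rw [Metric.mem_ball] at hz
      linarith
    exact hol_fderiv_bound (by positivity) hC
      (fun y hy => (hdf y (hs hy)).differentiableWithinAt) (fun y hy => (hball y (hs hy)).2)
  have hform : ∀ w ∈ Metric.ball w₀ (R / 4), fderiv ℂ f w v =
      (2 * Real.pi * Complex.I : ℂ)⁻¹ • ∫ t in (0:ℝ)..2 * Real.pi,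
        (deriv (circleMap 0 ρ) t * (circleMap 0 ρ t) ^ (-2 : ℤ)) • f (w + circleMap 0 ρ t • v) := by
    intro w hw
    have hD : ∀ z ∈ Metric.closedBall (0 : ℂ) ρ,
        HasDerivAt (fun z : ℂ => f (w + z • v)) (fderiv ℂ f (w + z • v) v) z := by
      intro z hz
      have h1 := (hdf _ (hsub (hmem w hw z hz))).hasFDerivAt
      have h2 : HasDerivAt (fun z : ℂ => w + z • v) v z := by
        simpa using ((hasDerivAt_id z).smul_const v).const_add w
      exact h1.comp_hasDerivAt z h2
    have hdc : DiffContOnCl ℂ (fun z : ℂ => f (w + z • v)) (Metric.ball 0 ρ) := by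
      apply DifferentiableOn.diffContOnCl
      rw [closure_ball _ hρ.ne']
      exact fun z hz => (hD z hz).differentiableAt.differentiableWithinAt
    have h0 := (hD 0 (by simp; positivity)).deriv
    have h3 := hdc.deriv_eq_smul_circleIntegral hρ
    rw [h0, zero_smul, add_zero] at h3
    rw [eq_inv_smul_iff₀ Complex.two_pi_I_ne_zero, ← h3]
    simp [circleIntegral, smul_smul]
  have hEq : (fun w => fderiv ℂ f w v) =ᶠ[nhds w₀] fun w =>
      (2 * Real.pi * Complex.I : ℂ)⁻¹ • ∫ t in (0:ℝ)..2 * Real.pi,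
        (deriv (circleMap 0 ρ) t * (circleMap 0 ρ t) ^ (-2 : ℤ)) • f (w + circleMap 0 ρ t • v) :=
    Filter.eventually_of_mem (Metric.ball_mem_nhds w₀ (by positivity)) hform
  refine DifferentiableAt.congr_of_eventuallyEq ?_ hEq
  refine DifferentiableAt.const_smul ?_ _
  have hcm : ∀ t, circleMap 0 ρ t ∈ Metric.closedBall (0 : ℂ) ρ := fun t =>
    circleMap_mem_closedBall 0 hρ.le t
  have hcne : ∀ t, circleMap 0 ρ t ≠ 0 := fun t => circleMap_ne_center hρ.ne'
  have hk : Continuous fun t : ℝ => deriv (circleMap 0 ρ) t * (circleMap 0 ρ t) ^ (-2 : ℤ) := by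
    simp only [deriv_circleMap]
    refine Continuous.mul (by fun_prop) ?_
    exact (continuous_circleMap 0 ρ).zpow₀ _ fun t => Or.inl (hcne t)
  have hcont : ∀ w ∈ Metric.ball w₀ (R / 4), Continuous fun t : ℝ =>
      (deriv (circleMap 0 ρ) t * (circleMap 0 ρ t) ^ (-2 : ℤ)) • f (w + circleMap 0 ρ t • v) := by
    intro w hw
    refine hk.smul (continuous_iff_continuousAt.2 fun t => ?_)
    have h1 := (hdf _ (hsub (hmem w hw _ (hcm t)))).continuousAt
    exact ContinuousAt.comp (f := fun t : ℝ => w + circleMap 0 ρ t • v) h1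
      (by fun_prop)
  have hw₀ : w₀ ∈ Metric.ball w₀ (R / 4) := Metric.mem_ball_self (by positivity)
  borelize E
  have key := intervalIntegral.hasFDerivAt_integral_of_dominated_of_fderiv_le
    (𝕜 := ℂ) (μ := MeasureTheory.volume) (a := 0) (b := 2 * Real.pi)
    (F := fun w t => (deriv (circleMap 0 ρ) t * (circleMap 0 ρ t) ^ (-2 : ℤ)) •
      f (w + circleMap 0 ρ t • v))
    (F' := fun w t => (deriv (circleMap 0 ρ) t * (circleMap 0 ρ t) ^ (-2 : ℤ)) •
      fderiv ℂ f (w + circleMap 0 ρ t • v))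
    (x₀ := w₀) (s := Metric.ball w₀ (R / 4))
    (bound := fun t => ‖deriv (circleMap 0 ρ) t * (circleMap 0 ρ t) ^ (-2 : ℤ)‖ * (C / (R / 4)))
    (Metric.ball_mem_nhds w₀ (by positivity))
    (Filter.eventually_of_mem (Metric.ball_mem_nhds w₀ (by positivity)) fun w hw =>
      (hcont w hw).aestronglyMeasurable)
    ((hcont w₀ hw₀).intervalIntegrable _ _)
    (hk.aestronglyMeasurable.smul
      (((measurable_fderiv ℂ f).comp (by fun_prop)).aestronglyMeasurable))
    (Filter.Eventually.of_forall fun t _ w hw => by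
      rw [norm_smul]
      exact mul_le_mul_of_nonneg_left (hbd _ (hmem w hw _ (hcm t))) (norm_nonneg _))
    ((hk.norm.mul continuous_const).intervalIntegrable _ _)
    (Filter.Eventually.of_forall fun t _ w hw => by
      have h1 := (hdf _ (hsub (hmem w hw _ (hcm t)))).hasFDerivAt
      have h2 : HasFDerivAt (fun w : E => w + circleMap 0 ρ t • v) (ContinuousLinearMap.id ℂ E) w :=
        (hasFDerivAt_id w).add_const _
      exact (h1.comp w h2).const_smul _)
  exact key.differentiableAt

theorem hol_fderiv_diff {E F : Type*} [NormedAddCommGroup E] [NormedSpace ℂ E]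
    [FiniteDimensional ℂ E]
    [NormedAddCommGroup F] [NormedSpace ℂ F] [FiniteDimensional ℂ F]
    {f : E → F} {U : Set E} (hU : IsOpen U) (hf : DifferentiableOn ℂ f U) :
    DifferentiableOn ℂ (fderiv ℂ f) U := by
  have : CompleteSpace F := FiniteDimensional.complete ℂ F
  have : CompleteSpace E := FiniteDimensional.complete ℂ E
  intro w hw
  refine DifferentiableAt.differentiableWithinAt ?_
  let e : (E →L[ℂ] F) ≃L[ℂ] (Fin (Module.finrank ℂ E) → F) :=
    (((ContinuousLinearEquiv.ofFinrankEq
      (by simp : Module.finrank ℂ E = Module.finrank ℂ (Fin (Module.finrank ℂ E) → ℂ))).arrowCongr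
        (1 : F ≃L[ℂ] F)).trans (ContinuousLinearEquiv.piRing (Fin (Module.finrank ℂ E))))
  rw [← Function.id_comp (fderiv ℂ f), ← e.symm_comp_self, Function.comp_assoc]
  refine e.symm.differentiableAt.comp w (differentiableAt_pi.2 fun i => ?_)
  exact hol_fderiv_apply_diff hU hf hw _

theorem hol_symm {E F : Type*} [NormedAddCommGroup E] [NormedSpace ℂ E]
    [FiniteDimensional ℂ E]
    [NormedAddCommGroup F] [NormedSpace ℂ F] [FiniteDimensional ℂ F]
    {f : E → F} {U : Set E} (hU : IsOpen U) (hf : DifferentiableOn ℂ f U) {w : E} (hw : w ∈ U)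
    (v v' : E) :
    fderiv ℂ (fderiv ℂ f) w v v' = fderiv ℂ (fderiv ℂ f) w v' v := by
  have h1 := hol_fderiv_diff hU hf
  refine second_derivative_symmetric_of_eventually (f := f) (f' := fderiv ℂ f) (x := w) ?_
    ((h1.differentiableAt (hU.mem_nhds hw)).hasFDerivAt) v v'
  filter_upwards [hU.mem_nhds hw] with y hy
  exact (hf.differentiableAt (hU.mem_nhds hy)).hasFDerivAt

theorem proj_alg {ι E : Type*} [AddCommGroup E] [Module ℂ E] (b : Module.Basis ι ℂ E)
    (B : E →ₗ[ℂ] E →ₗ[ℂ] E) (hs : ∀ v v', B v v' = B v' v)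
    (h : ∀ v i j, b.repr v i * b.repr (B v v) j = b.repr v j * b.repr (B v v) i) (a c : ι) :
    B (b a) (b c) = (b.repr (B (b a) (b a)) a / 2) • b c + (b.repr (B (b c) (b c)) c / 2) • b a := by
  classical
  have hdiag : ∀ a i, i ≠ a → b.repr (B (b a) (b a)) i = 0 := by
    intro a i hi
    have := h (b a) i a
    simp [hi.symm] at this
    exact this.symm
  rcases eq_or_ne a c with rfl | hac
  · apply b.repr.injective
    ext i
    rcases eq_or_ne i a with rfl | hi
    · simp
    · simp [hdiag a i hi, hi.symm]
  · have h1 := fun i j => h (b a + b c) i j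
    have h2 := fun i j => h (b a - b c) i j
    simp only [map_add, map_sub, LinearMap.add_apply, LinearMap.sub_apply, hs (b c) (b a),
      Finsupp.add_apply, Finsupp.sub_apply, Module.Basis.repr_self] at h1 h2
    apply b.repr.injective
    ext i
    have da := hdiag a c hac.symm
    have dc := hdiag c a hac
    have h1ac := h1 a c
    have h2ac := h2 a c
    simp [hac, hac.symm, da, dc] at h1ac h2ac
    rcases eq_or_ne i a with rfl | hia
    · simp [hac.symm]
      linear_combination -(1/4) * h1ac - (1/4) * h2ac
    rcases eq_or_ne i c with rfl | hic
    · simp [hac]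
      linear_combination (1/4) * h1ac - (1/4) * h2ac
    · have h1i := h1 a i
      simp [hia.symm, hic.symm, hac.symm, hdiag a i hia,
        hdiag c i hic] at h1i
      simp [hia.symm, hic.symm]
      linear_combination h1i

theorem proj_integrate {ι E : Type*} [NormedAddCommGroup E] [NormedSpace ℂ E]
    [FiniteDimensional ℂ E] [Nontrivial ι] (b : Module.Basis ι ℂ E)
    {U : Set E} (hU : IsOpen U) (hUc : IsPreconnected U) {Θ : E → E}
    (hΘ : DifferentiableOn ℂ Θ U) (l : ι → E → ℂ)
    (hl : ∀ a, DifferentiableOn ℂ (l a) U)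
    (h : ∀ w ∈ U, ∀ a c, fderiv ℂ (fderiv ℂ Θ) w (b a) (b c) = l a w • b c + l c w • b a) :
    ∃ (a : E) (A : E →ₗ[ℂ] E) (lam : E →ₗ[ℂ] ℂ), ∀ w ∈ U, Θ w = a + A w + lam w • w := by
  classical
  have hΘ1 := hol_fderiv_diff hU hΘ
  have hL : ∀ w ∈ U, ∀ a c d, fderiv ℂ (l a) w (b d) • b c + fderiv ℂ (l c) w (b d) • b a
      = fderiv ℂ (l d) w (b a) • b c + fderiv ℂ (l c) w (b a) • b d := by
    intro w hw a c d
    have hg : DifferentiableOn ℂ (fun w => fderiv ℂ Θ w (b c)) U :=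
      hΘ1.clm_apply (differentiableOn_const _)
    have hg1 := hol_fderiv_diff hU hg
    have key : ∀ a d, fderiv ℂ (fderiv ℂ (fun w => fderiv ℂ Θ w (b c))) w (b d) (b a) =
        fderiv ℂ (l a) w (b d) • b c + fderiv ℂ (l c) w (b d) • b a := by
      intro a d
      have e1 : fderiv ℂ (fun w => fderiv ℂ (fun w => fderiv ℂ Θ w (b c)) w (b a)) w (b d) =
          fderiv ℂ (fderiv ℂ (fun w => fderiv ℂ Θ w (b c))) w (b d) (b a) := by
        rw [fderiv_clm_apply (hg1.differentiableAt (hU.mem_nhds hw)) (differentiableAt_const _)]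
        simp
      have e2 : (fun w => fderiv ℂ (fun w => fderiv ℂ Θ w (b c)) w (b a)) =ᶠ[nhds w]
          fun w => l a w • b c + l c w • b a := by
        filter_upwards [hU.mem_nhds hw] with y hy
        rw [fderiv_clm_apply (hΘ1.differentiableAt (hU.mem_nhds hy)) (differentiableAt_const _)]
        simp [h y hy]
      rw [← e1, e2.fderiv_eq]
      have da := ((hl a).differentiableAt (hU.mem_nhds hw)).hasFDerivAt
      have dc := ((hl c).differentiableAt (hU.mem_nhds hw)).hasFDerivAt
      rw [((da.smul_const (b c)).fun_add (dc.smul_const (b a))).fderiv]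
      simp
    rw [← key a d, ← key d a]
    exact hol_symm hU hg hw _ _
  have hL0 : ∀ w ∈ U, ∀ a, fderiv ℂ (l a) w = 0 := by
    intro w hw a
    have hne : ∀ a d, a ≠ d → fderiv ℂ (l a) w (b a) = 0 ∧
        2 * fderiv ℂ (l a) w (b d) = fderiv ℂ (l d) w (b a) := by
      intro a d had
      have := congrArg b.repr (hL w hw a a d)
      have h1 := DFunLike.congr_fun this a
      have h2 := DFunLike.congr_fun this d
      simp [had, had.symm] at h1 h2
      refine ⟨h2.symm, ?_⟩
      linear_combination h1
    apply ContinuousLinearMap.coe_injective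
    apply b.ext
    intro d
    rcases eq_or_ne a d with rfl | had
    · obtain ⟨d, hd⟩ := exists_ne a
      simpa using (hne a d hd.symm).1
    · have h1 := (hne a d had).2
      have h2 := (hne d a had.symm).2
      simp
      linear_combination (2/3) * h1 + (1/3) * h2
  have hc : ∀ a, ∃ c, ∀ w ∈ U, l a w = c := fun a =>
    hU.exists_is_const_of_fderiv_eq_zero hUc (hl a) fun w hw => hL0 w hw a
  choose lc hlc using hc
  let lam0 : E →ₗ[ℂ] ℂ := b.constr ℂ lc
  let lam : E →L[ℂ] ℂ := LinearMap.toContinuousLinearMap lam0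
  have hlam : ∀ a, lam (b a) = lc a := fun a => by simp [lam, lam0]
  let T : E →L[ℂ] E →L[ℂ] E := lam.smulRight (ContinuousLinearMap.id ℂ E) +
    ContinuousLinearMap.smulRightL ℂ E E lam
  have hT : ∀ v v', T v v' = lam v • v' + lam v' • v := by
    intro v v'
    simp [T]
  have hD2 : ∀ w ∈ U, fderiv ℂ (fderiv ℂ Θ) w = T := by
    intro w hw
    apply ContinuousLinearMap.coe_injective
    apply b.ext
    intro a
    apply ContinuousLinearMap.coe_injective
    apply b.ext
    intro c
    simp [h w hw, hT, hlam, hlc _ w hw]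
  obtain ⟨A, hA⟩ := hU.exists_eq_add_of_fderiv_eq hUc hΘ1 T.differentiable.differentiableOn
    (fun w hw => by rw [hD2 w hw]; simp)
  have hH : ∀ w, HasFDerivAt (fun w => lam w • w + A w) (T w + A) w := by
    intro w
    have := (lam.hasFDerivAt (x := w)).smul (hasFDerivAt_id w) |>.add (A.hasFDerivAt (x := w))
    refine this.congr_fderiv ?_
    ext v
    simp [hT]
  obtain ⟨a, ha⟩ := hU.exists_eq_add_of_fderiv_eq hUc hΘ
    (g := fun w => lam w • w + A w) (fun w _ => (hH w).differentiableAt.differentiableWithinAt)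
    (fun w hw => by rw [(hH w).fderiv]; exact hA hw)
  refine ⟨a, A, lam, fun w hw => ?_⟩
  rw [ha hw]
  simp
  abel

theorem proj_snd_fderiv {E : Type*} [NormedAddCommGroup E] [NormedSpace ℂ E]
    [FiniteDimensional ℂ E] {U : Set E} (hU : IsOpen U) {Θ : E → E}
    (a : E) (A : E →ₗ[ℂ] E) (lam : E →ₗ[ℂ] ℂ)
    (h : ∀ w ∈ U, Θ w = a + A w + lam w • w) {w : E} (hw : w ∈ U) (v v' : E) :
    fderiv ℂ (fderiv ℂ Θ) w v v' = lam v • v' + lam v' • v := by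
  let lam' : E →L[ℂ] ℂ := LinearMap.toContinuousLinearMap lam
  let A' : E →L[ℂ] E := LinearMap.toContinuousLinearMap A
  let T : E →L[ℂ] E →L[ℂ] E := lam'.smulRight (ContinuousLinearMap.id ℂ E) +
    ContinuousLinearMap.smulRightL ℂ E E lam'
  have hT : ∀ v v', T v v' = lam v • v' + lam v' • v := by
    intro v v'
    simp [T, lam']
  have hH : ∀ w, HasFDerivAt (fun w => lam' w • w + A' w + a) (T w + A') w := by
    intro w
    have := ((lam'.hasFDerivAt (x := w)).smul (hasFDerivAt_id w) |>.add
      (A'.hasFDerivAt (x := w))).add_const a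
    refine this.congr_fderiv ?_
    ext v
    simp [hT, lam']
  have h1 : ∀ w ∈ U, fderiv ℂ Θ w = T w + A' := by
    intro w hw
    rw [← (hH w).fderiv]
    apply Filter.EventuallyEq.fderiv_eq
    filter_upwards [hU.mem_nhds hw] with y hy
    rw [h y hy]
    simp [lam', A']
    abel
  have h2 : fderiv ℂ Θ =ᶠ[nhds w] fun w => T w + A' := by
    filter_upwards [hU.mem_nhds hw] with y hy using h1 y hy
  rw [h2.fderiv_eq, ((T.hasFDerivAt (x := w)).add_const A').fderiv, hT]

/-- The vector `e_i + q_i` spanning the graph of `q`. -/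
def jv {n m : ℕ} (q : Jsp n m) (i : Fin n) : Wsp n m :=
  ((Pi.single i 1 : Fin n → ℂ), fun k => q k i)

theorem jv_eq {n m : ℕ} (q : Jsp n m) (i : Fin n) :
    jv q i = ((Pi.single i 1 : Fin n → ℂ), (0 : Fin m → ℂ)) +
      ∑ k, q k i • ((0 : Fin n → ℂ), (Pi.single k 1 : Fin m → ℂ)) := by
  ext a
  · simp [jv, Prod.fst_sum]
  · simp [jv, Prod.snd_sum, Finset.sum_apply, Pi.single_apply]

theorem Dtot_eq {n m : ℕ} (ψ : Wsp n m → ℂ) (i : Fin n) (p : Psp n m) :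
    Dtot ψ i p = fderiv ℂ ψ p.1 (jv p.2 i) := by
  rw [jv_eq, map_add, map_sum]
  simp only [map_smul, smul_eq_mul, Dtot]

theorem DtotF_eq {n m : ℕ} (φ : Psp n m → ℂ) (i : Fin n) (p : Psp n m) :
    DtotF (fun _ _ _ _ => 0) φ i p = fderiv ℂ φ p (jv p.2 i, 0) := by
  have : ((jv p.2 i, 0) : Psp n m) = dirx n m i + ∑ k, p.2 k i • diru n m k := by
    ext a
    · simp [jv_eq, dirx, diru, Prod.fst_sum]
    · simp [jv_eq, dirx, diru, Prod.fst_sum, Prod.snd_sum]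
    · simp [dirx, diru, Prod.snd_sum]
  rw [this, map_add, map_sum]
  simp [DtotF]

theorem jv_diff {n m : ℕ} (i : Fin n) :
    Differentiable ℂ (fun p : Psp n m => jv p.2 i) := by
  unfold jv
  fun_prop

theorem eta2_eq {n m : ℕ} (θ : Fin n → Wsp n m → ℂ) (η : Fin m → Wsp n m → ℂ)
    (μ : Fin m) (i j : Fin n) (p : Psp n m)
    (hθ : ∀ k, DifferentiableAt ℂ (fderiv ℂ (θ k)) p.1)
    (hη : ∀ k, DifferentiableAt ℂ (fderiv ℂ (η k)) p.1) :
    eta2 (fun _ _ _ _ => 0) θ η μ i j p =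
      fderiv ℂ (fderiv ℂ (η μ)) p.1 (jv p.2 j) (jv p.2 i) -
        ∑ k, fderiv ℂ (fderiv ℂ (θ k)) p.1 (jv p.2 j) (jv p.2 i) * p.2 μ k := by
  obtain ⟨w, q⟩ := p
  simp only at hθ hη
  have hE : eta1 θ η μ i = fun p : Psp n m => fderiv ℂ (η μ) p.1 (jv p.2 i) -
      ∑ k, fderiv ℂ (θ k) p.1 (jv p.2 i) * p.2 μ k := by
    funext p
    simp [eta1, Dtot_eq]
  have hcd : ∀ ψ : Wsp n m → ℂ, DifferentiableAt ℂ (fderiv ℂ ψ) w →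
      DifferentiableAt ℂ (fun p : Psp n m => fderiv ℂ ψ p.1 (jv p.2 i)) (w, q) := by
    intro ψ hψ
    exact DifferentiableAt.clm_apply
      (DifferentiableAt.comp (w, q) (f := fun p : Psp n m => p.1) hψ differentiableAt_fst)
      (jv_diff i _)
  have hdiff : DifferentiableAt ℂ (eta1 θ η μ i) (w, q) := by
    rw [hE]
    refine (hcd _ (hη μ)).sub (DifferentiableAt.fun_sum fun k _ => (hcd _ (hθ k)).mul ?_)
    fun_prop
  have hline : HasFDerivAt (fun y : Wsp n m => ((y, q) : Psp n m))
      (ContinuousLinearMap.inl ℂ (Wsp n m) (Jsp n m)) w :=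
    hasFDerivAt_prodMk_left w q
  have h1 := hdiff.hasFDerivAt.comp w hline
  have h2 : HasFDerivAt (fun y : Wsp n m => eta1 θ η μ i (y, q))
      ((fderiv ℂ (fderiv ℂ (η μ)) w).flip (jv q i) -
        ∑ k, q μ k • (fderiv ℂ (fderiv ℂ (θ k)) w).flip (jv q i)) w := by
    rw [hE]
    have hd : ∀ ψ : Wsp n m → ℂ, DifferentiableAt ℂ (fderiv ℂ ψ) w →
      HasFDerivAt (fun y => fderiv ℂ ψ y (jv q i)) ((fderiv ℂ (fderiv ℂ ψ) w).flip (jv q i)) w := by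
      intro ψ hψ
      have := hψ.hasFDerivAt.clm_apply (hasFDerivAt_const (jv q i) w)
      refine this.congr_fderiv ?_
      ext v <;> simp
    exact (hd _ (hη μ)).sub (HasFDerivAt.fun_sum fun k _ => (hd _ (hθ k)).mul_const (q μ k))
  have h3 := h1.unique h2
  have h4 := DFunLike.congr_fun h3 (jv q j)
  simp only [eta2, DtotF_eq, mul_zero, Finset.sum_const_zero, sub_zero]
  simp only [ContinuousLinearMap.comp_apply, ContinuousLinearMap.inl_apply] at h4
  rw [h4]
  simp [mul_comm]

theorem snd_fderiv_comp {E : Type*} [NormedAddCommGroup E] [NormedSpace ℂ E]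
    [FiniteDimensional ℂ E] {U : Set E} (hU : IsOpen U) {Θ : E → E}
    (hΘ : DifferentiableOn ℂ Θ U) (ℓ : E →L[ℂ] ℂ) {w : E} (hw : w ∈ U) (v v' : E) :
    fderiv ℂ (fderiv ℂ (fun y => ℓ (Θ y))) w v v' = ℓ (fderiv ℂ (fderiv ℂ Θ) w v v') := by
  have h1 : fderiv ℂ (fun y => ℓ (Θ y)) =ᶠ[nhds w] fun y => ℓ.comp (fderiv ℂ Θ y) := by
    filter_upwards [hU.mem_nhds hw] with y hy
    exact (ℓ.hasFDerivAt.comp y (hΘ.differentiableAt (hU.mem_nhds hy)).hasFDerivAt).fderiv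
  rw [h1.fderiv_eq]
  have h2 := ((hol_fderiv_diff hU hΘ).differentiableAt (hU.mem_nhds hw)).hasFDerivAt
  have h3 : HasFDerivAt (fun y => ℓ.comp (fderiv ℂ Θ y))
      ((ContinuousLinearMap.compL ℂ E E ℂ ℓ).comp (fderiv ℂ (fderiv ℂ Θ) w)) w :=
    (ContinuousLinearMap.compL ℂ E E ℂ ℓ).hasFDerivAt.comp w h2
  rw [h3.fderiv]
  simp

theorem graph_alg {n m : ℕ} (B : Wsp n (m + 1) →ₗ[ℂ] Wsp n (m + 1) →ₗ[ℂ] Wsp n (m + 1))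
    (h : ∀ (q : Jsp n (m + 1)) (i j : Fin n) (μ : Fin (m + 1)),
      (B (jv q j) (jv q i)).2 μ = ∑ k, (B (jv q j) (jv q i)).1 k * q μ k)
    (v : Wsp n (m + 1)) (hv : v.1 ≠ 0) : ∃ c : ℂ, B v v = c • v := by
  obtain ⟨x, u⟩ := v
  obtain ⟨i₀, hi₀⟩ := Function.ne_iff.1 hv
  simp only [Pi.zero_apply] at hi₀
  have hq : ∀ q : Jsp n (m + 1), (∀ μ, ∑ i, x i * q μ i = u μ) →
      ∀ μ, (B (x, u) (x, u)).2 μ = ∑ k, (B (x, u) (x, u)).1 k * q μ k := by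
    intro q hqu μ
    have hV : ((x, u) : Wsp n (m + 1)) = ∑ i, x i • jv q i := by
      ext a
      · simp [jv, Prod.fst_sum, Finset.sum_apply, Pi.single_apply]
      · simp [jv, Prod.snd_sum, Finset.sum_apply, hqu]
    rw [hV]
    simp only [map_sum, map_smul, LinearMap.sum_apply, LinearMap.smul_apply, Prod.fst_sum,
      Prod.snd_sum, Finset.sum_apply, Prod.smul_fst, Prod.smul_snd, Pi.smul_apply, smul_eq_mul, h,
      Finset.mul_sum, Finset.sum_mul]
    rw [Finset.sum_comm_cycle]
    exact Finset.sum_congr rfl fun _ _ => Finset.sum_congr rfl fun _ _ =>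
      Finset.sum_congr rfl fun _ _ => by ring
  let q₁ : Jsp n (m + 1) := fun μ k => if k = i₀ then u μ / x i₀ else 0
  have h1 := hq q₁ (fun μ => by simp [q₁]; field_simp)
  have hx : ∀ j, x i₀ * (B (x, u) (x, u)).1 j = x j * (B (x, u) (x, u)).1 i₀ := by
    intro j
    have h2 := hq (fun μ k => q₁ μ k + ((if k = j then x i₀ else 0) - if k = i₀ then x j else 0))
      (fun μ => by simp [q₁, mul_add, mul_sub, Finset.sum_add_distrib]; field_simp; ring) 0
    rw [h1 0] at h2
    simp only [mul_add, mul_sub, Finset.sum_add_distrib, Finset.sum_sub_distrib] at h2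
    simp at h2
    linear_combination h2
  refine ⟨(B (x, u) (x, u)).1 i₀ / x i₀, ?_⟩
  ext a
  · simp
    field_simp
    linear_combination hx a
  · rw [h1 a]
    simp [q₁]
    ring

theorem graph_alg' {n m : ℕ} {ι : Type*} (b : Module.Basis ι ℂ (Wsp (n + 1) (m + 1)))
    (B : Wsp (n + 1) (m + 1) →ₗ[ℂ] Wsp (n + 1) (m + 1) →ₗ[ℂ] Wsp (n + 1) (m + 1))
    (h : ∀ (q : Jsp (n + 1) (m + 1)) (i j : Fin (n + 1)) (μ : Fin (m + 1)),
      (B (jv q j) (jv q i)).2 μ = ∑ k, (B (jv q j) (jv q i)).1 k * q μ k)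
    (v : Wsp (n + 1) (m + 1)) (i j : ι) :
    b.repr v i * b.repr (B v v) j = b.repr v j * b.repr (B v v) i := by
  have main : ∀ v : Wsp (n + 1) (m + 1), v.1 ≠ 0 →
      b.repr v i * b.repr (B v v) j = b.repr v j * b.repr (B v v) i := by
    intro v hv
    obtain ⟨c, hc⟩ := graph_alg B h v hv
    rw [hc]
    simp
    ring
  by_cases hv : v.1 = 0
  · let e : Wsp (n + 1) (m + 1) := (Pi.single 0 1, 0)
    have ht : ∀ t : ℂ, t ≠ 0 → (v + t • e).1 ≠ 0 := by
      intro t ht h0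
      have := congrFun h0 0
      simp [hv, e] at this
      exact ht this
    have e1 := main _ (ht 1 one_ne_zero)
    have e2 := main _ (ht (-1) (by norm_num))
    have e3 := main _ (ht 2 (by norm_num))
    have e4 := main _ (ht (-2) (by norm_num))
    simp only [map_add, map_smul, LinearMap.add_apply, LinearMap.smul_apply, Finsupp.add_apply,
      Finsupp.smul_apply, smul_eq_mul] at e1 e2 e3 e4
    linear_combination (2/3) * e1 + (2/3) * e2 - (1/6) * e3 - (1/6) * e4
  · exact main v hv

theorem wsp_decomp {n m : ℕ} (w : Wsp n m) :
    w = ∑ s, w.1 s • ((Pi.single s 1 : Fin n → ℂ), (0 : Fin m → ℂ)) +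
      ∑ k, w.2 k • ((0 : Fin n → ℂ), (Pi.single k 1 : Fin m → ℂ)) := by
  ext a
  · simp [Prod.fst_sum, Finset.sum_apply, Pi.single_apply]
  · simp [Prod.snd_sum, Finset.sum_apply, Pi.single_apply]

theorem symm_iff {n m : ℕ}
    (U : Set (Wsp n m)) (hUo : IsOpen U)
    (θ : Fin n → Wsp n m → ℂ) (η : Fin m → Wsp n m → ℂ)
    (hθ : ∀ j, DifferentiableOn ℂ (θ j) U)
    (hη : ∀ μ, DifferentiableOn ℂ (η μ) U) (Θ : Wsp n m → Wsp n m)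
    (hΘ : Θ = fun w => (fun j => θ j w, fun μ => η μ w)) :
    IsSymmetry U Set.univ (fun _ _ _ _ => 0) θ η ↔
      ∀ w ∈ U, ∀ (q : Jsp n m) (i j : Fin n) (μ : Fin m),
      (fderiv ℂ (fderiv ℂ Θ) w (jv q j) (jv q i)).2 μ =
        ∑ k, (fderiv ℂ (fderiv ℂ Θ) w (jv q j) (jv q i)).1 k * q μ k := by
  have hΘd : DifferentiableOn ℂ Θ U := by
    rw [hΘ]
    exact (differentiableOn_pi.2 hθ).prodMk (differentiableOn_pi.2 hη)
  have c1 : ∀ w ∈ U, ∀ k v v', fderiv ℂ (fderiv ℂ (θ k)) w v v' =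
      (fderiv ℂ (fderiv ℂ Θ) w v v').1 k := by
    intro w hw k v v'
    have := snd_fderiv_comp hUo hΘd ((ContinuousLinearMap.proj k).comp
      (ContinuousLinearMap.fst ℂ (Fin n → ℂ) (Fin m → ℂ))) hw v v'
    have e : (fun y => ((ContinuousLinearMap.proj k).comp
      (ContinuousLinearMap.fst ℂ (Fin n → ℂ) (Fin m → ℂ))) (Θ y)) = θ k := by
      rw [hΘ]; rfl
    rw [e] at this
    exact this
  have c2 : ∀ w ∈ U, ∀ k v v', fderiv ℂ (fderiv ℂ (η k)) w v v' =
      (fderiv ℂ (fderiv ℂ Θ) w v v').2 k := by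
    intro w hw k v v'
    have := snd_fderiv_comp hUo hΘd ((ContinuousLinearMap.proj k).comp
      (ContinuousLinearMap.snd ℂ (Fin n → ℂ) (Fin m → ℂ))) hw v v'
    have e : (fun y => ((ContinuousLinearMap.proj k).comp
      (ContinuousLinearMap.snd ℂ (Fin n → ℂ) (Fin m → ℂ))) (Θ y)) = η k := by
      rw [hΘ]; rfl
    rw [e] at this
    exact this
  have key : ∀ w ∈ U, ∀ (q : Jsp n m) (i j : Fin n) (μ : Fin m),
      eta2 (fun _ _ _ _ => 0) θ η μ i j (w, q) =
      (fderiv ℂ (fderiv ℂ Θ) w (jv q j) (jv q i)).2 μ -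
        ∑ k, (fderiv ℂ (fderiv ℂ Θ) w (jv q j) (jv q i)).1 k * q μ k := by
    intro w hw q i j μ
    rw [eta2_eq θ η μ i j (w, q)
      (fun k => (hol_fderiv_diff hUo (hθ k)).differentiableAt (hUo.mem_nhds hw))
      (fun k => (hol_fderiv_diff hUo (hη k)).differentiableAt (hUo.mem_nhds hw))]
    simp only [c1 w hw, c2 w hw]
  constructor
  · intro h w hw q i j μ
    have := h (w, q) ⟨hw, Set.mem_univ _⟩ i j μ
    rw [key w hw] at this
    simpa [sub_eq_zero] using this
  · rintro h ⟨w, q⟩ ⟨hw, -⟩ i j μ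
    rw [key w hw, h w hw]
    simp

/-- A pair `(θ, η)` of holomorphic functions on a connected open set
`U ⊆ ℂⁿ × ℂᵐ` is an infinitesimal symmetry of the trivial system `(S_0) : u^k_{x_i x_j} = 0`
if and only if there exist `a ∈ ℂ^{n+m}`, a complex linear map `A : ℂ^{n+m} → ℂ^{n+m}` and
`λ ∈ ℂ^{n+m}` such that, writing `Θ = (θ, η)` and `w = (x, u)`,
`Θ(w) = a + A(w) + (Σ_s λ_s w_s)·w` for all `w ∈ U`. -/
theorem statement3 {n m : ℕ}
    (U : Set (Wsp (n + 1) (m + 1)))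
    (hUo : IsOpen U) (hUc : IsConnected U)
    (θ : Fin (n + 1) → Wsp (n + 1) (m + 1) → ℂ)
    (η : Fin (m + 1) → Wsp (n + 1) (m + 1) → ℂ)
    (hθ : ∀ j, DifferentiableOn ℂ (θ j) U)
    (hη : ∀ μ, DifferentiableOn ℂ (η μ) U) :
    IsSymmetry U Set.univ (fun _ _ _ _ => 0) θ η ↔
      ∃ (a : Wsp (n + 1) (m + 1)) (A : Wsp (n + 1) (m + 1) →ₗ[ℂ] Wsp (n + 1) (m + 1))
        (lam : Wsp (n + 1) (m + 1)),
        ∀ w ∈ U,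
          ((fun j => θ j w, fun μ => η μ w) : Wsp (n + 1) (m + 1)) =
            a + A w + ((∑ s, lam.1 s * w.1 s) + ∑ k, lam.2 k * w.2 k) • w := by
  let Θ : Wsp (n + 1) (m + 1) → Wsp (n + 1) (m + 1) :=
    fun w => (fun j => θ j w, fun μ => η μ w)
  have hΘd : DifferentiableOn ℂ Θ U :=
    (differentiableOn_pi.2 hθ).prodMk (differentiableOn_pi.2 hη)
  rw [symm_iff U hUo θ η hθ hη Θ rfl]
  constructor
  · intro h
    let b := (Pi.basisFun ℂ (Fin (n + 1))).prod (Pi.basisFun ℂ (Fin (m + 1)))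
    have : Nontrivial (Fin (n + 1) ⊕ Fin (m + 1)) := ⟨Sum.inl 0, Sum.inr 0, by simp⟩
    have hΘ1 := hol_fderiv_diff hUo hΘd
    have hΘ2 := hol_fderiv_diff hUo hΘ1
    obtain ⟨a, A, lam, hA⟩ := proj_integrate b hUo hUc.isPreconnected hΘd
      (fun a w => b.repr (fderiv ℂ (fderiv ℂ Θ) w (b a) (b a)) a / 2)
      (fun a => by
        have h1 : DifferentiableOn ℂ (fun w => fderiv ℂ (fderiv ℂ Θ) w (b a) (b a)) U :=
          (hΘ2.clm_apply (differentiableOn_const _)).clm_apply (differentiableOn_const _)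
        have h2 : DifferentiableOn ℂ
            (fun w => b.repr (fderiv ℂ (fderiv ℂ Θ) w (b a) (b a)) a) U :=
          (LinearMap.toContinuousLinearMap (b.coord a)).differentiable.comp_differentiableOn h1
        simp only [div_eq_mul_inv]
        exact h2.mul_const _)
      (fun w hw a c => by
        let B : Wsp (n + 1) (m + 1) →ₗ[ℂ] Wsp (n + 1) (m + 1) →ₗ[ℂ] Wsp (n + 1) (m + 1) :=
          (ContinuousLinearMap.coeLM ℂ).comp (fderiv ℂ (fderiv ℂ Θ) w).toLinearMap
        have hB : ∀ v v', B v v' = fderiv ℂ (fderiv ℂ Θ) w v v' := fun _ _ => rfl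
        have := proj_alg b B (fun v v' => hol_symm hUo hΘd hw v v')
          (graph_alg' b B (fun q i j μ => h w hw q i j μ)) a c
        exact this)
    refine ⟨a, A, (fun s => lam (Pi.single s 1, 0), fun k => lam (0, Pi.single k 1)),
      fun w hw => ?_⟩
    have e : lam w = (∑ s, lam (Pi.single s 1, 0) * w.1 s) +
        ∑ k, lam (0, Pi.single k 1) * w.2 k := by
      conv_lhs => rw [wsp_decomp w]
      simp only [map_add, map_sum, map_smul, smul_eq_mul, mul_comm]
    have h3 := hA w hw
    rw [e] at h3
    exact h3
  · rintro ⟨a, A, lam, hA⟩ w hw q i j μ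
    let lam0 : Wsp (n + 1) (m + 1) →ₗ[ℂ] ℂ :=
      { toFun := fun w => (∑ s, lam.1 s * w.1 s) + ∑ k, lam.2 k * w.2 k
        map_add' := fun x y => by
          simp only [Prod.fst_add, Prod.snd_add, Pi.add_apply, mul_add, Finset.sum_add_distrib]
          ring
        map_smul' := fun c x => by
          simp only [Prod.smul_fst, Prod.smul_snd, Pi.smul_apply, smul_eq_mul, RingHom.id_apply,
            mul_add, Finset.mul_sum, mul_left_comm] }
    rw [proj_snd_fderiv hUo a A lam0 (fun w hw => hA w hw) hw]
    simp [jv, add_mul, Finset.sum_add_distrib, Pi.single_apply]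
end
end

section
/- Let n ≥ 0, let S = {Z ∈ ℂ^{n+1} : Σ_j |Z_j|² = 1} be the unit sphere, and let U ⊆ ℂ^{n+1} be a connected open set with U ∩ S ≠ ∅. If X = (X_1,…,X_{n+1}) : U → ℂ^{n+1} is holomorphic and Σ_{j=1}^{n+1} X_j(Z)·conj(Z_j) = 0 for every Z ∈ S ∩ U, then X ≡ 0 on U. Equivalently: if the real parts of both X and iX are tangent to S at every point of S ∩ U, then X vanishes identically. -/
open scoped BigOperators

noncomputable section

open Filter Topology

/-- The first-order consequence of the tangency condition along a great circle. -/
theorem aux_curve {n : ℕ} {U : Set (Fin (n + 1) → ℂ)} (hUo : IsOpen U)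
    {X : (Fin (n + 1) → ℂ) → (Fin (n + 1) → ℂ)}
    (htan : ∀ Z : Fin (n + 1) → ℂ, (∑ j, Complex.normSq (Z j)) = 1 → Z ∈ U →
      (∑ j, X Z j * (starRingEnd ℂ) (Z j)) = 0)
    {Z : Fin (n + 1) → ℂ} (hZ : (∑ j, Complex.normSq (Z j)) = 1) (hZU : Z ∈ U)
    {D : (Fin (n + 1) → ℂ) →L[ℂ] (Fin (n + 1) → ℂ)} (hD : HasFDerivAt X D Z)
    {v : Fin (n + 1) → ℂ} (hv : (∑ j, Complex.normSq (v j)) = 1)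
    (hvZ : (∑ j, v j * (starRingEnd ℂ) (Z j)) = 0) :
    (∑ j, (D v j * (starRingEnd ℂ) (Z j) + X Z j * (starRingEnd ℂ) (v j))) = 0 := by
  set γ : ℝ → (Fin (n + 1) → ℂ) := fun t => Real.cos t • Z + Real.sin t • v with hγ
  have hγ0 : γ 0 = Z := by simp [hγ]
  have hγd : HasDerivAt γ v 0 := by
    have h1 := ((Real.hasDerivAt_cos 0).smul_const Z).add ((Real.hasDerivAt_sin 0).smul_const v)
    simpa [hγ] using! h1
  have hXγ : HasDerivAt (fun t => X (γ t)) (D v) 0 := by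
    have h1 : HasFDerivAt X (D.restrictScalars ℝ) (γ 0) := by
      rw [hγ0]; exact hD.restrictScalars ℝ
    exact h1.comp_hasDerivAt 0 hγd
  have hXj : ∀ j, HasDerivAt (fun t => X (γ t) j) (D v j) 0 := fun j => hasDerivAt_pi.1 hXγ j
  have hγj : ∀ j, HasDerivAt (fun t => (starRingEnd ℂ) (γ t j)) ((starRingEnd ℂ) (v j)) 0 := by
    intro j
    exact (hasDerivAt_pi.1 hγd j).star
  have hsum : HasDerivAt (fun t => ∑ j, X (γ t) j * (starRingEnd ℂ) (γ t j))
      (∑ j, (D v j * (starRingEnd ℂ) (Z j) + X Z j * (starRingEnd ℂ) (v j))) 0 := by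
    have := HasDerivAt.fun_sum (u := Finset.univ) (fun j _ => (hXj j).mul (hγj j))
    simpa [hγ0] using! this
  have hS : ∀ t, (∑ j, Complex.normSq (γ t j)) = 1 := by
    intro t
    have h1 : ∀ j, Complex.normSq (γ t j) = Real.cos t ^ 2 * Complex.normSq (Z j)
        + Real.sin t ^ 2 * Complex.normSq (v j)
        + 2 * Real.cos t * Real.sin t * (v j * (starRingEnd ℂ) (Z j)).re := by
      intro j
      simp [hγ, Complex.normSq_apply, -Complex.ofReal_cos, -Complex.ofReal_sin]
      ring
    simp_rw [h1, Finset.sum_add_distrib, ← Finset.mul_sum]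
    rw [← Complex.re_sum, hvZ, hZ, hv]
    simp
  have hev : (fun t => ∑ j, X (γ t) j * (starRingEnd ℂ) (γ t j)) =ᶠ[𝓝 0] fun _ => 0 := by
    have h1 : ∀ᶠ t in 𝓝 (0 : ℝ), γ t ∈ U :=
      hγd.continuousAt.eventually_mem (by rw [hγ0]; exact hUo.mem_nhds hZU)
    filter_upwards [h1] with t ht
    exact htan _ (hS t) ht
  exact hsum.unique ((hasDerivAt_const (0 : ℝ) (0 : ℂ)).congr_of_eventuallyEq hev)

/-- The field vanishes on the sphere. -/
theorem aux_sphere {n : ℕ} {U : Set (Fin (n + 1) → ℂ)} (hUo : IsOpen U)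
    {X : (Fin (n + 1) → ℂ) → (Fin (n + 1) → ℂ)} (hX : DifferentiableOn ℂ X U)
    (htan : ∀ Z : Fin (n + 1) → ℂ, (∑ j, Complex.normSq (Z j)) = 1 → Z ∈ U →
      (∑ j, X Z j * (starRingEnd ℂ) (Z j)) = 0)
    {Z : Fin (n + 1) → ℂ} (hZ : (∑ j, Complex.normSq (Z j)) = 1) (hZU : Z ∈ U) :
    X Z = 0 := by
  have hD := (hX.differentiableAt (hUo.mem_nhds hZU)).hasFDerivAt
  set D := fderiv ℂ X Z
  by_contra hne
  have hNpos : 0 < ∑ j, Complex.normSq (X Z j) := by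
    obtain ⟨j, hj⟩ := Function.ne_iff.1 hne
    exact Finset.sum_pos' (fun i _ => Complex.normSq_nonneg _)
      ⟨j, Finset.mem_univ _, Complex.normSq_pos.2 hj⟩
  set N := ∑ j, Complex.normSq (X Z j) with hN
  set r : ℝ := (Real.sqrt N)⁻¹ with hr
  have hr2 : r ^ 2 * N = 1 := by
    rw [hr, inv_pow, Real.sq_sqrt hNpos.le, inv_mul_cancel₀ hNpos.ne']
  have hr0 : r ≠ 0 := by rintro h; simp [h] at hr2
  have key : ∀ c : ℂ, Complex.normSq c = r ^ 2 →
      c * (∑ j, D (X Z) j * (starRingEnd ℂ) (Z j)) + (starRingEnd ℂ) c * N = 0 := by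
    intro c hc
    have h1 : (∑ j, Complex.normSq ((c • X Z) j)) = 1 := by
      simp [Complex.normSq_mul, ← Finset.mul_sum, hc, ← hN, hr2]
    have h2 : (∑ j, (c • X Z) j * (starRingEnd ℂ) (Z j)) = 0 := by
      simp [mul_assoc, ← Finset.mul_sum, htan Z hZ hZU]
    have h3 := aux_curve hUo htan hZ hZU hD h1 h2
    rw [← h3, hN, Finset.sum_add_distrib, Finset.mul_sum]
    push_cast
    rw [Finset.mul_sum]
    congr 1
    · simp [mul_assoc]
    · refine Finset.sum_congr rfl fun j _ => ?_
      rw [Complex.normSq_eq_conj_mul_self]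
      simp; ring
  have k1 := key r (by simp [Complex.normSq_apply]; ring)
  have k2 := key (Complex.I * r) (by simp [Complex.normSq_apply]; ring)
  simp only [map_mul, Complex.conj_I, Complex.conj_ofReal] at k1 k2
  have k3 : (2 : ℂ) * r * N = 0 := by
    linear_combination k1 + Complex.I * k2 - ((r : ℂ) * (∑ j, D (X Z) j * (starRingEnd ℂ) (Z j)) - r * N) * Complex.I_sq
  have : (r : ℂ) ≠ 0 := by exact_mod_cast hr0
  have : (N : ℂ) ≠ 0 := by exact_mod_cast hNpos.ne'
  simp_all

/-- One-variable identity principle along a complex line in a convex open set. -/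
theorem aux_line {E F : Type*} [NormedAddCommGroup E] [NormedSpace ℂ E]
    [NormedAddCommGroup F] [NormedSpace ℂ F] [CompleteSpace F] {B : Set E} (hBo : IsOpen B)
    (hBc : Convex ℝ B) {g : E → F} (hg : DifferentiableOn ℂ g B) (z w : E) (c₀ : ℂ)
    (h₀ : z + c₀ • w ∈ B) (hf : ∃ᶠ c in 𝓝[≠] c₀, g (z + c • w) = 0) (c : ℂ)
    (hc : z + c • w ∈ B) : g (z + c • w) = 0 := by
  set l : ℂ → E := fun c => z + c • w with hl
  have hld : Differentiable ℂ l := by fun_prop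
  have ho : IsOpen (l ⁻¹' B) := hBo.preimage hld.continuous
  have hcv : Convex ℝ (l ⁻¹' B) := by
    intro x hx y hy a b ha hb hab
    have := hBc hx hy ha hb hab
    have e : a • l x + b • l y = l (a • x + b • y) := by
      have : z = a • z + b • z := by rw [← add_smul, hab, one_smul]
      simp only [hl]
      rw [smul_add, smul_add, add_smul, smul_assoc, smul_assoc]
      nth_rewrite 3 [this]
      abel
    rw [e] at this
    exact this
  have hd : DifferentiableOn ℂ (fun c => g (l c)) (l ⁻¹' B) :=
    hg.comp hld.differentiableOn (fun x hx => hx)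
  exact (hd.analyticOnNhd ho).eqOn_zero_of_preconnected_of_frequently_eq_zero
    hcv.isPreconnected h₀ hf hc

/-- Identity principle on a connected open set. -/
theorem aux_identity {E F : Type*} [NormedAddCommGroup E] [NormedSpace ℂ E]
    [NormedAddCommGroup F] [NormedSpace ℂ F] [CompleteSpace F] {U : Set E} (hUo : IsOpen U)
    (hUc : IsPreconnected U) {g : E → F} (hg : DifferentiableOn ℂ g U) {p : E} (hp : p ∈ U)
    (h : ∀ᶠ z in 𝓝 p, g z = 0) : ∀ z ∈ U, g z = 0 := by
  have hsub : U ⊆ {z | ∀ᶠ y in 𝓝 z, g y = 0} := by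
    refine hUc.subset_of_closure_inter_subset isOpen_setOf_eventually_nhds ⟨p, hp, h⟩ ?_
    rintro q ⟨hq, hqU⟩
    obtain ⟨ε, hε, hB⟩ := Metric.isOpen_iff.1 hUo q hqU
    obtain ⟨y, hy, hyq⟩ := Metric.mem_closure_iff.1 hq ε hε
    have hyB : y ∈ Metric.ball q ε := by rwa [Metric.mem_ball, dist_comm]
    filter_upwards [Metric.ball_mem_nhds q hε] with x hx
    have hfr : ∀ᶠ c : ℂ in 𝓝 0, g (y + c • (x - y)) = 0 := by
      have : Tendsto (fun c : ℂ => y + c • (x - y)) (𝓝 0) (𝓝 y) := by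
        have : Continuous (fun c : ℂ => y + c • (x - y)) := by fun_prop
        simpa using this.tendsto 0
      exact this.eventually hy
    have := aux_line Metric.isOpen_ball (convex_ball q ε) (hg.mono hB) y (x - y) 0
      (by simpa using hyB) (hfr.filter_mono nhdsWithin_le_nhds).frequently 1
      (by simpa using hx)
    simpa using this
  intro z hz
  exact (hsub hz).self_of_nhds

theorem aux_circle {s : ℝ} (hs : 0 < s) :
    ∃ᶠ c : ℂ in 𝓝[≠] (s : ℂ), Complex.normSq c = s ^ 2 := by
  have hd : HasDerivAt (fun t : ℝ => (s : ℂ) * Complex.exp (t * Complex.I)) (s * Complex.I) 0 := by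
    have h1 : HasDerivAt (fun t : ℂ => (s : ℂ) * Complex.exp (t * Complex.I)) (s * Complex.I)
        ((0 : ℝ) : ℂ) := by
      have := (((hasDerivAt_id ((0 : ℝ) : ℂ)).mul_const Complex.I).cexp).const_mul (s : ℂ)
      simpa using! this
    exact h1.comp_ofReal
  have ht := hd.tendsto_nhdsNE (by simp [hs.ne'])
  simp only [Complex.ofReal_zero, zero_mul, Complex.exp_zero, mul_one] at ht
  refine ht.frequently (Eventually.frequently (Eventually.of_forall fun t => ?_))
  rw [Complex.normSq_eq_norm_sq, norm_mul, Complex.norm_exp_ofReal_mul_I]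
  simp

/-- A holomorphic map vanishing on the sphere vanishes near each point of the sphere. -/
theorem aux_near {n : ℕ} {F : Type*} [NormedAddCommGroup F] [NormedSpace ℂ F] [CompleteSpace F]
    {U : Set (Fin (n + 1) → ℂ)} (hUo : IsOpen U)
    {g : (Fin (n + 1) → ℂ) → F} (hg : DifferentiableOn ℂ g U)
    (hS : ∀ Z : Fin (n + 1) → ℂ, (∑ j, Complex.normSq (Z j)) = 1 → Z ∈ U → g Z = 0)
    {p : Fin (n + 1) → ℂ} (hp : (∑ j, Complex.normSq (p j)) = 1) (hpU : p ∈ U) :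
    ∀ᶠ Z in 𝓝 p, g Z = 0 := by
  obtain ⟨ε, hε, hB⟩ := Metric.isOpen_iff.1 hUo p hpU
  have hpp : (∑ j, p j * (starRingEnd ℂ) (p j)) = 1 := by
    simp_rw [Complex.mul_conj]
    exact_mod_cast hp
  set a : (Fin (n + 1) → ℂ) → ℂ := fun Z => ∑ j, Z j * (starRingEnd ℂ) (p j) with ha
  set w : (Fin (n + 1) → ℂ) → (Fin (n + 1) → ℂ) := fun Z => Z - a Z • p with hw
  set q : (Fin (n + 1) → ℂ) → ℝ := fun Z => 1 - ∑ j, Complex.normSq (w Z j) with hq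
  have hac : Continuous a := by fun_prop
  have hwc : Continuous w := by fun_prop
  have hqc : Continuous q := by
    refine continuous_const.sub (continuous_finset_sum _ fun j _ => ?_)
    exact Complex.continuous_normSq.comp ((continuous_apply j).comp hwc)
  have hap : a p = 1 := hpp
  have hwp : w p = 0 := by simp [hw, hap]
  have hqp : q p = 1 := by simp [hq, hwp]
  have e1 : ∀ᶠ Z in 𝓝 p, 0 < q Z :=
    hqc.continuousAt.eventually_const_lt (by rw [hqp]; exact one_pos)
  have hmc : Continuous (fun Z => w Z + ((Real.sqrt (q Z) : ℝ) : ℂ) • p) :=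
    hwc.add ((Complex.continuous_ofReal.comp hqc.sqrt).smul continuous_const)
  have e2 : ∀ᶠ Z in 𝓝 p, w Z + ((Real.sqrt (q Z) : ℝ) : ℂ) • p ∈ Metric.ball p ε := by
    refine hmc.continuousAt.eventually_mem ?_
    simp only [hwp, hqp, Real.sqrt_one, Complex.ofReal_one, one_smul, zero_add]
    exact Metric.ball_mem_nhds p hε
  filter_upwards [e1, e2, Metric.ball_mem_nhds p hε] with Z h1 h2 h3
  have hZ : w Z + a Z • p = Z := by simp [hw]
  have hworth : (∑ j, w Z j * (starRingEnd ℂ) (p j)) = 0 := by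
    simp only [hw, Pi.sub_apply, Pi.smul_apply, smul_eq_mul, sub_mul, Finset.sum_sub_distrib,
      mul_assoc, ← Finset.mul_sum, hpp]
    simp [ha]
  have hnorm : ∀ c : ℂ, (∑ j, Complex.normSq ((w Z + c • p) j))
      = (1 - q Z) + Complex.normSq c := by
    intro c
    have h1 : ∀ j, Complex.normSq ((w Z + c • p) j) = Complex.normSq (w Z j)
        + Complex.normSq c * Complex.normSq (p j)
        + 2 * ((starRingEnd ℂ) c * (w Z j * (starRingEnd ℂ) (p j))).re := by
      intro j
      rw [Pi.add_apply, Complex.normSq_add, Pi.smul_apply, smul_eq_mul, Complex.normSq_mul,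
        map_mul]
      congr 3
      ring
    simp_rw [h1, Finset.sum_add_distrib, ← Finset.mul_sum]
    rw [← Complex.re_sum, ← Finset.mul_sum, hworth, hp]
    simp [hq]
  have hin : ∀ᶠ c : ℂ in 𝓝[≠] ((Real.sqrt (q Z) : ℝ) : ℂ), w Z + c • p ∈ U := by
    have hc : Continuous (fun c : ℂ => w Z + c • p) := by fun_prop
    exact (hc.continuousAt.eventually_mem (hUo.mem_nhds (hB h2))).filter_mono nhdsWithin_le_nhds
  have hfr := ((aux_circle (Real.sqrt_pos.2 h1)).and_eventually hin).mono
    (q := fun c => g (w Z + c • p) = 0) (by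
      rintro c ⟨hc, hcU⟩
      refine hS _ ?_ hcU
      rw [hnorm, hc, Real.sq_sqrt h1.le]
      ring)
  have := aux_line Metric.isOpen_ball (convex_ball p ε) (hg.mono hB) (w Z) p _ h2 hfr (a Z)
    (by rw [hZ]; exact h3)
  rwa [hZ] at this

/-- Let `n ≥ 0`, `S = {Z ∈ ℂ^{n+1} : Σ_j |Z_j|² = 1}` the unit sphere
and `U ⊆ ℂ^{n+1}` a connected open set with `U ∩ S ≠ ∅`.  If `X : U → ℂ^{n+1}` is
holomorphic and `Σ_j X_j(Z)·conj(Z_j) = 0` for every `Z ∈ S ∩ U` (i.e. the real parts of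
both `X` and `iX` are tangent to `S` along `S ∩ U`), then `X ≡ 0` on `U`. -/
theorem statement11 (n : ℕ) (U : Set (Fin (n + 1) → ℂ))
    (hUo : IsOpen U) (hUc : IsConnected U)
    (hne : (U ∩ {Z : Fin (n + 1) → ℂ | (∑ j, Complex.normSq (Z j)) = 1}).Nonempty)
    (X : (Fin (n + 1) → ℂ) → (Fin (n + 1) → ℂ))
    (hX : DifferentiableOn ℂ X U)
    (htan : ∀ Z ∈ {Z : Fin (n + 1) → ℂ | (∑ j, Complex.normSq (Z j)) = 1} ∩ U,
      (∑ j, X Z j * (starRingEnd ℂ) (Z j)) = 0) :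
    ∀ Z ∈ U, X Z = 0 := by
  obtain ⟨p, hpU, hp⟩ := hne
  have htan' : ∀ Z : Fin (n + 1) → ℂ, (∑ j, Complex.normSq (Z j)) = 1 → Z ∈ U →
      (∑ j, X Z j * (starRingEnd ℂ) (Z j)) = 0 := fun Z h1 h2 => htan Z ⟨h1, h2⟩
  exact aux_identity hUo hUc.isPreconnected hX hpU
    (aux_near hUo hX (fun Z h1 h2 => aux_sphere hUo hX htan' h1 h2) hp hpU)
end
end
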